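/- Fix α > 0 with α ∉ ℤ. There exists a constant C > 0 such that for every m ∈ ℤ with m ≠ 0: |G_{m,0}(r,r')| ≤ (C/|m+α|) (r/r')^{|m|} whenever 0 < r < r' ≤ 1; |G_{m,0}(r,r')| ≤ (C/|m+α|) (r/r')^{|m+α|} whenever 1 ≤ r < r'; and |G_{m,0}(r,r')| ≤ (C/|m+α|) r^{|m|} (r')^{-|m+α|} whenever 0 < r < 1 < r'. -/

import Mathlib

open scoped Real

noncomputable section

/-- The Pochhammer symbol `(a)ₙ = a (a+1) ⋯ (a+n−1)`. -/
noncomputable def poch (a : ℝ) (n : ℕ) : ℝ := ∏ k ∈ Finset.range n, (a + k)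

/-- The Kummer confluent hypergeometric function `M(a,b,z)`. -/
noncomputable def kummerM (a b z : ℝ) : ℝ :=
  ∑' n : ℕ, (poch a n / poch b n) * z ^ n / (n.factorial : ℝ)

/-- Tricomi's confluent hypergeometric function `U(a,b,z)` for `a > 0`, `z > 0`,
via its integral representation. -/
noncomputable def tricomiU (a b z : ℝ) : ℝ :=
  (Real.Gamma a)⁻¹ * ∫ t in Set.Ioi (0:ℝ), Real.exp (-(z*t)) * t ^ (a-1) * (1+t) ^ (b-a-1)

/-- `v_m(r) = e^{-αr} (2αr)^{|m|} M(1/2+|m|+m, 1+2|m|, 2αr)`. -/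
noncomputable def vm (α : ℝ) (m : ℤ) (r : ℝ) : ℝ :=
  Real.exp (-(α*r)) * (2*α*r) ^ (m.natAbs) *
    kummerM (1/2 + (m.natAbs : ℝ) + (m : ℝ)) (1 + 2*(m.natAbs:ℝ)) (2*α*r)

/-- `u_m(r) = e^{-αr} (2αr)^{|m|} U(1/2+|m|+m, 1+2|m|, 2αr)`. -/
noncomputable def um (α : ℝ) (m : ℤ) (r : ℝ) : ℝ :=
  Real.exp (-(α*r)) * (2*α*r) ^ (m.natAbs) *
    tricomiU (1/2 + (m.natAbs : ℝ) + (m : ℝ)) (1 + 2*(m.natAbs:ℝ)) (2*α*r)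

/-- The denominator `a'_m + |m+α| a_m`. -/
noncomputable def denomG (α : ℝ) (m : ℤ) : ℝ := deriv (vm α m) 1 + |(m:ℝ) + α| * vm α m 1

open Classical in
/-- The kernel `G_{m,0}(r,r')` for `r ≤ r'`. -/
noncomputable def Gm0aux (α : ℝ) (m : ℤ) (r r' : ℝ) : ℝ :=
  if r' ≤ 1 then
    (Real.Gamma (1/2 + (m:ℝ) + (m.natAbs:ℝ)) / Real.Gamma (1 + 2*(m.natAbs:ℝ))) * vm α m r *
      (um α m r' - ((deriv (um α m) 1 + |(m:ℝ) + α| * um α m 1) / denomG α m) * vm α m r')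
  else if r ≤ 1 then
    vm α m r * r' ^ (-|(m:ℝ) + α|) / denomG α m
  else
    (1/(2*|(m:ℝ) + α|)) * ((r/r') ^ |(m:ℝ) + α| -
      ((deriv (vm α m) 1 - |(m:ℝ) + α| * vm α m 1) / denomG α m) * (r*r') ^ (-|(m:ℝ) + α|))

open Classical in
/-- The kernel `G_{m,0}(r,r')`, symmetric in its arguments. -/
noncomputable def Gm0 (α : ℝ) (m : ℤ) (r r' : ℝ) : ℝ :=
  if r ≤ r' then Gm0aux α m r r' else Gm0aux α m r' r

open MeasureTheory Set Filter Topology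

lemma integrableOn_exp_mul_one_add_pow (n : ℕ) {z : ℝ} (hz : 0 < z) :
    IntegrableOn (fun t : ℝ => Real.exp (-(z * t)) * (1 + t) ^ n) (Ioi 0) ∧
    ∫ t in Ioi (0 : ℝ), Real.exp (-(z * t)) * (1 + t) ^ n
      ≤ Real.exp z * n.factorial / z ^ (n + 1) := by
  set h : ℝ → ℝ := (Ioi (0 : ℝ)).indicator (fun t => Real.exp (-(z * t)) * t ^ n) with h_def
  have hint : Integrable h := by
    rw [h_def, integrable_indicator_iff measurableSet_Ioi]
    have := integrableOn_rpow_mul_exp_neg_mul_rpow (p := 1) (s := n) (b := z)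
      (by linarith [(Nat.cast_nonneg n : (0 : ℝ) ≤ n)]) one_pos hz
    refine this.congr_fun (fun t _ => ?_) measurableSet_Ioi
    simp [mul_comm]
  have hval : ∫ t, h t = n.factorial / z ^ (n + 1) := by
    rw [h_def, integral_indicator measurableSet_Ioi]
    have := Real.integral_rpow_mul_exp_neg_mul_Ioi (a := n + 1) (r := z) (by positivity) hz
    rw [Real.Gamma_nat_eq_factorial, add_sub_cancel_right] at this
    rw [div_eq_mul_one_div, mul_comm, ← one_div_pow, ← Real.rpow_natCast (1 / z)]
    push_cast
    rw [← this]
    refine setIntegral_congr_fun measurableSet_Ioi (fun t _ => ?_)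
    simp [mul_comm]
  have hnn : ∀ t, 0 ≤ h t := fun t => indicator_nonneg (fun s hs => by
    have : (0 : ℝ) < s := hs
    positivity) t
  have hshift := hint.comp_add_right 1
  have heq : EqOn (fun t => Real.exp z * h (t + 1))
      (fun t : ℝ => Real.exp (-(z * t)) * (1 + t) ^ n) (Ioi 0) := by
    intro t ht
    have ht' : (0 : ℝ) < t := ht
    have : t + 1 ∈ Ioi (0 : ℝ) := by simp only [mem_Ioi]; linarith
    simp only [h_def, indicator_of_mem this]
    rw [← mul_assoc, ← Real.exp_add, add_comm t 1]
    ring_nf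
  refine ⟨((hshift.const_mul (Real.exp z)).integrableOn).congr_fun heq measurableSet_Ioi, ?_⟩
  rw [← setIntegral_congr_fun measurableSet_Ioi heq, integral_const_mul, mul_div_assoc, ← hval,
    ← integral_add_right_eq_self h 1]
  exact mul_le_mul_of_nonneg_left
    (setIntegral_le_integral hshift (ae_of_all _ fun t => hnn _)) (Real.exp_pos z).le

/-- The integrand in Tricomi's function with `b = n + 1`. -/
def tricomiKernel (a : ℝ) (n : ℕ) (t : ℝ) : ℝ := t ^ (a - 1) * (1 + t) ^ ((n : ℝ) - a)

lemma tricomiKernel_nonneg (a : ℝ) (n : ℕ) {t : ℝ} (ht : 0 < t) : 0 ≤ tricomiKernel a n t := by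
  unfold tricomiKernel; positivity

lemma continuousOn_tricomiKernel (a : ℝ) (n : ℕ) : ContinuousOn (tricomiKernel a n) (Ioi 0) := by
  intro t ht
  have ht' : (0 : ℝ) < t := ht
  unfold tricomiKernel
  refine ContinuousAt.continuousWithinAt (ContinuousAt.mul ?_ ?_)
  · exact continuousAt_id.rpow_const (Or.inl ht'.ne')
  · exact (continuousAt_const.add continuousAt_id).rpow_const
      (Or.inl (add_pos one_pos ht').ne')

lemma mul_tricomiKernel_le {a : ℝ} (ha : 0 < a) (n : ℕ) {t : ℝ} (ht : 0 < t) :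
    t * tricomiKernel a n t ≤ (1 + t) ^ n := by
  unfold tricomiKernel
  rw [← mul_assoc, ← Real.rpow_one_add' ht.le (by linarith), add_sub_cancel]
  calc t ^ a * (1 + t) ^ ((n : ℝ) - a) ≤ (1 + t) ^ a * (1 + t) ^ ((n : ℝ) - a) := by
        gcongr; linarith
    _ = (1 + t) ^ n := by
        rw [← Real.rpow_add (by linarith), add_sub_cancel, Real.rpow_natCast]

lemma tricomiKernel_le {a : ℝ} (ha : 1 / 2 ≤ a) (k : ℕ) {t : ℝ} (ht : 0 < t) :
    tricomiKernel a (k + 1) t ≤ 2 * (1 + t) ^ k +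
      (Ioc (0 : ℝ) 1).indicator (fun t => 2 ^ (k + 1) * t ^ (-(1 / 2) : ℝ)) t := by
  have h1 : tricomiKernel a (k + 1) t ≤
      t ^ (-(1 / 2) : ℝ) * (1 + t) ^ ((k : ℝ) + 1 / 2) := by
    unfold tricomiKernel
    calc t ^ (a - 1) * (1 + t) ^ (((k + 1 : ℕ) : ℝ) - a)
        = t ^ (-(1 / 2) : ℝ) * (t ^ (a - 1 / 2) * (1 + t) ^ (((k + 1 : ℕ) : ℝ) - a)) := by
          rw [← mul_assoc, ← Real.rpow_add ht]; ring_nf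
      _ ≤ t ^ (-(1 / 2) : ℝ) * ((1 + t) ^ (a - 1 / 2) * (1 + t) ^ (((k + 1 : ℕ) : ℝ) - a)) := by
          gcongr
          linarith
      _ = _ := by
          rw [← Real.rpow_add (by linarith)]; push_cast; ring_nf
  refine h1.trans ?_
  by_cases h : t ≤ 1
  · rw [indicator_of_mem (show t ∈ Ioc (0 : ℝ) 1 from ⟨ht, h⟩)]
    have : (1 + t) ^ ((k : ℝ) + 1 / 2) ≤ 2 ^ (k + 1) := by
      calc (1 + t) ^ ((k : ℝ) + 1 / 2) ≤ (2 : ℝ) ^ ((k : ℝ) + 1 / 2) := by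
            gcongr; linarith
        _ ≤ (2 : ℝ) ^ (((k + 1 : ℕ) : ℝ)) := by
            apply Real.rpow_le_rpow_of_exponent_le one_le_two; push_cast; linarith
        _ = _ := Real.rpow_natCast _ _
    calc t ^ (-(1 / 2) : ℝ) * (1 + t) ^ ((k : ℝ) + 1 / 2)
        ≤ t ^ (-(1 / 2) : ℝ) * 2 ^ (k + 1) := by gcongr
      _ = 2 ^ (k + 1) * t ^ (-(1 / 2) : ℝ) := mul_comm _ _
      _ ≤ _ := by
        have : 0 ≤ 2 * (1 + t) ^ k := by positivity
        linarith
  · rw [indicator_of_notMem (fun h' => h h'.2), add_zero, Real.rpow_add (by linarith),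
      Real.rpow_natCast]
    push Not at h
    have h2 : t ^ (-(1 / 2) : ℝ) * (1 + t) ^ (1 / 2 : ℝ) ≤ 2 := by
      rw [Real.rpow_neg ht.le, inv_mul_le_iff₀ (by positivity), mul_comm]
      rw [← Real.sqrt_eq_rpow, ← Real.sqrt_eq_rpow, Real.sqrt_le_left (by positivity), mul_pow,
        Real.sq_sqrt ht.le]
      linarith
    nlinarith [pow_pos (by linarith : (0 : ℝ) < 1 + t) k]

lemma integrableOn_indicator_rpow_neg_half (c : ℝ) :
    IntegrableOn ((Ioc (0 : ℝ) 1).indicator (fun t => c * t ^ (-(1 / 2) : ℝ))) (Ioi 0) ∧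
    ∫ t in Ioi (0 : ℝ), (Ioc (0 : ℝ) 1).indicator (fun t => c * t ^ (-(1 / 2) : ℝ)) t = 2 * c := by
  constructor
  · apply Integrable.integrableOn
    rw [integrable_indicator_iff measurableSet_Ioc,
      ← intervalIntegrable_iff_integrableOn_Ioc_of_le zero_le_one]
    exact (intervalIntegral.intervalIntegrable_rpow' (by norm_num)).const_mul _
  · rw [setIntegral_indicator measurableSet_Ioc, inter_eq_right.mpr Ioc_subset_Ioi_self,
      ← intervalIntegral.integral_of_le zero_le_one, intervalIntegral.integral_const_mul,
      integral_rpow (Or.inl (by norm_num))]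
    norm_num
    ring

lemma aestronglyMeasurable_exp_mul_tricomiKernel (a : ℝ) (n : ℕ) (z : ℝ) :
    AEStronglyMeasurable (fun t => Real.exp (-(z * t)) * tricomiKernel a n t)
      (volume.restrict (Ioi 0)) :=
  ((by fun_prop : Continuous fun t => Real.exp (-(z * t))).continuousOn.mul
    (continuousOn_tricomiKernel a n)).aestronglyMeasurable measurableSet_Ioi

/-- The Laplace transform of `tricomiKernel`. -/
def tricomiIntegral (a : ℝ) (n : ℕ) (z : ℝ) : ℝ :=
  ∫ t in Ioi (0 : ℝ), Real.exp (-(z * t)) * tricomiKernel a n t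

lemma tricomiIntegral_nonneg (a : ℝ) (n : ℕ) (z : ℝ) : 0 ≤ tricomiIntegral a n z :=
  setIntegral_nonneg measurableSet_Ioi fun _ ht =>
    mul_nonneg (Real.exp_pos _).le (tricomiKernel_nonneg a n ht)

lemma integrableOn_tricomi_and_le {a : ℝ} (ha : 1 / 2 ≤ a) (k : ℕ) {z : ℝ} (hz : 0 < z) :
    IntegrableOn (fun t => Real.exp (-(z * t)) * tricomiKernel a (k + 1) t) (Ioi 0) ∧
    tricomiIntegral a (k + 1) z ≤ 2 * (Real.exp z * k.factorial / z ^ (k + 1)) +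
      2 * 2 ^ (k + 1) := by
  obtain ⟨hi, hle⟩ := integrableOn_exp_mul_one_add_pow k hz
  obtain ⟨hi', heq⟩ := integrableOn_indicator_rpow_neg_half (2 ^ (k + 1))
  have hb : ∀ t ∈ Ioi (0 : ℝ), Real.exp (-(z * t)) * tricomiKernel a (k + 1) t ≤
      2 * (Real.exp (-(z * t)) * (1 + t) ^ k) +
      (Ioc (0 : ℝ) 1).indicator (fun t => 2 ^ (k + 1) * t ^ (-(1 / 2) : ℝ)) t := by
    intro t ht
    have ht' : (0 : ℝ) < t := ht
    have h0 : 0 ≤ (Ioc (0 : ℝ) 1).indicator (fun t => 2 ^ (k + 1) * t ^ (-(1 / 2) : ℝ)) t :=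
      indicator_nonneg (fun s hs => by have := hs.1; positivity) t
    have h1 : Real.exp (-(z * t)) ≤ 1 := Real.exp_le_one_iff.mpr (by nlinarith)
    have h2 := mul_le_mul_of_nonneg_left (tricomiKernel_le ha k ht) (Real.exp_pos (-(z * t))).le
    nlinarith
  have hnn : ∀ t ∈ Ioi (0 : ℝ), 0 ≤ Real.exp (-(z * t)) * tricomiKernel a (k + 1) t :=
    fun t ht => mul_nonneg (Real.exp_pos _).le (tricomiKernel_nonneg a _ ht)
  have hint : IntegrableOn (fun t => 2 * (Real.exp (-(z * t)) * (1 + t) ^ k) +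
      (Ioc (0 : ℝ) 1).indicator (fun t => 2 ^ (k + 1) * t ^ (-(1 / 2) : ℝ)) t) (Ioi 0) :=
    (hi.const_mul 2).add hi'
  refine ⟨hint.mono' (aestronglyMeasurable_exp_mul_tricomiKernel a _ z) ?_, ?_⟩
  · filter_upwards [self_mem_ae_restrict measurableSet_Ioi] with t ht
    rw [Real.norm_of_nonneg (hnn t ht)]
    exact hb t ht
  · refine (integral_mono_of_nonneg ?_ hint ?_).trans ?_
    · filter_upwards [self_mem_ae_restrict measurableSet_Ioi] with t ht using hnn t ht
    · filter_upwards [self_mem_ae_restrict measurableSet_Ioi] with t ht using hb t ht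
    · rw [integral_add (hi.const_mul 2) hi', heq, integral_const_mul]
      linarith

lemma pow_mul_tricomiIntegral_le {a α : ℝ} (ha : 1 / 2 ≤ a) (k : ℕ) {z : ℝ}
    (hz : 0 < z) (hzα : z ≤ 2 * α) :
    z ^ (k + 1) * tricomiIntegral a (k + 1) z ≤
      (2 * Real.exp (2 * α) + 8 * α * Real.exp (4 * α)) * k.factorial := by
  have h := mul_le_mul_of_nonneg_left (integrableOn_tricomi_and_le ha k hz).2
    (pow_nonneg hz.le (k + 1))
  have hα : 0 < α := by linarith
  have h1 : z ^ (k + 1) * (2 * (Real.exp z * k.factorial / z ^ (k + 1))) ≤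
      2 * Real.exp (2 * α) * k.factorial := by
    have : z ^ (k + 1) * (2 * (Real.exp z * k.factorial / z ^ (k + 1))) =
      2 * Real.exp z * k.factorial := by field_simp
    rw [this]; gcongr
  have h2 : z ^ (k + 1) * (2 * 2 ^ (k + 1)) ≤ 8 * α * Real.exp (4 * α) * k.factorial := by
    have h3 := Real.pow_div_factorial_le_exp (4 * α) (by positivity) k
    rw [div_le_iff₀ (by positivity)] at h3
    calc z ^ (k + 1) * (2 * 2 ^ (k + 1)) ≤ (2 * α) ^ (k + 1) * (2 * 2 ^ (k + 1)) := by gcongr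
      _ = 8 * α * (4 * α) ^ k := by
        rw [mul_left_comm, ← mul_pow, pow_succ]; ring_nf
      _ ≤ 8 * α * (Real.exp (4 * α) * k.factorial) := by gcongr
      _ = _ := by ring
  rw [mul_add] at h
  linarith

lemma exists_hasDerivAt_tricomiIntegral {a : ℝ} (ha : 1 / 2 ≤ a) (k : ℕ) {z : ℝ} (hz : 0 < z) :
    ∃ d : ℝ, HasDerivAt (tricomiIntegral a (k + 1)) d z ∧
      z ^ (k + 2) * |d| ≤ Real.exp z * (k + 1).factorial := by
  have hdom : ∀ {y t : ℝ}, 0 < t → |Real.exp (-(y * t)) * -t * tricomiKernel a (k + 1) t| ≤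
      Real.exp (-(y * t)) * (1 + t) ^ (k + 1) := by
    intro y t ht
    rw [mul_assoc, abs_mul, Real.abs_exp, neg_mul, abs_neg,
      abs_of_nonneg (mul_nonneg ht.le (tricomiKernel_nonneg a _ ht))]
    gcongr
    exact mul_tricomiKernel_le (by linarith) _ ht
  obtain ⟨hi, hle⟩ := integrableOn_exp_mul_one_add_pow (k + 1) hz
  have key := hasDerivAt_integral_of_dominated_loc_of_deriv_le
    (μ := volume.restrict (Ioi (0 : ℝ))) (x₀ := z) (s := Ioi (z / 2))
    (F := fun y t => Real.exp (-(y * t)) * tricomiKernel a (k + 1) t)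
    (F' := fun y t => Real.exp (-(y * t)) * -t * tricomiKernel a (k + 1) t)
    (bound := fun t => Real.exp (-(z / 2 * t)) * (1 + t) ^ (k + 1))
    (Ioi_mem_nhds (by linarith))
    (Eventually.of_forall fun y => aestronglyMeasurable_exp_mul_tricomiKernel a _ y)
    (integrableOn_tricomi_and_le ha k hz).1
    (((by fun_prop : Continuous fun t => Real.exp (-(z * t)) * -t).continuousOn.mul
      (continuousOn_tricomiKernel a _)).aestronglyMeasurable measurableSet_Ioi)
    (by
      filter_upwards [self_mem_ae_restrict measurableSet_Ioi] with t ht y hy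
      have ht' : (0 : ℝ) < t := ht
      have hy' : z / 2 < y := hy
      refine (hdom ht).trans ?_
      gcongr)
    (integrableOn_exp_mul_one_add_pow (k + 1) (half_pos hz)).1
    (ae_of_all _ fun t y _ => by
      have h := ((hasDerivAt_mul_const (x := y) t).neg.exp).mul_const (tricomiKernel a (k + 1) t)
      exact h)
  refine ⟨_, key.2, ?_⟩
  have h2 : |∫ t in Ioi (0 : ℝ), Real.exp (-(z * t)) * -t * tricomiKernel a (k + 1) t| ≤
      Real.exp z * (k + 1).factorial / z ^ (k + 2) := by
    rw [← Real.norm_eq_abs]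
    refine le_trans (norm_integral_le_of_norm_le hi ?_) hle
    filter_upwards [self_mem_ae_restrict measurableSet_Ioi] with t ht using hdom ht
  rwa [le_div_iff₀ (by positivity), mul_comm] at h2

lemma poch_div_nonneg {a b : ℝ} (ha : 0 < a) (hab : a ≤ b) (n : ℕ) : 0 ≤ poch a n / poch b n := by
  have hb : 0 < b := by linarith
  unfold poch
  exact div_nonneg (Finset.prod_nonneg fun _ _ => by positivity)
    (Finset.prod_nonneg fun _ _ => by positivity)

lemma poch_div_le_one {a b : ℝ} (ha : 0 < a) (hab : a ≤ b) (n : ℕ) : poch a n / poch b n ≤ 1 := by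
  have hb : 0 < b := by linarith
  unfold poch
  refine div_le_one_of_le₀ (Finset.prod_le_prod (fun _ _ => by positivity) fun _ _ => by linarith)
    (Finset.prod_nonneg fun _ _ => by positivity)

lemma norm_kummerM_term_le {a b : ℝ} (ha : 0 < a) (hab : a ≤ b) (z : ℝ) (n : ℕ) :
    ‖poch a n / poch b n * z ^ n / (n.factorial : ℝ)‖ ≤ |z| ^ n / n.factorial := by
  rw [norm_div, norm_mul, Real.norm_of_nonneg (poch_div_nonneg ha hab n), norm_pow,
    Real.norm_natCast, Real.norm_eq_abs]
  gcongr
  exact mul_le_of_le_one_left (by positivity) (poch_div_le_one ha hab n)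

lemma summable_kummerM {a b : ℝ} (ha : 0 < a) (hab : a ≤ b) (z : ℝ) :
    Summable fun n : ℕ => poch a n / poch b n * z ^ n / (n.factorial : ℝ) :=
  .of_norm_bounded (Real.summable_pow_div_factorial |z|) (norm_kummerM_term_le ha hab z)

lemma kummerM_le_exp {a b z : ℝ} (ha : 0 < a) (hab : a ≤ b) (hz : 0 ≤ z) :
    kummerM a b z ≤ Real.exp z := by
  rw [Real.exp_eq_exp_ℝ, NormedSpace.exp_eq_tsum_div]
  refine (summable_kummerM ha hab z).tsum_le_tsum (fun n => ?_) (Real.summable_pow_div_factorial z)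
  gcongr
  exact mul_le_of_le_one_left (by positivity) (poch_div_le_one ha hab n)

lemma one_le_kummerM {a b z : ℝ} (ha : 0 < a) (hab : a ≤ b) (hz : 0 ≤ z) :
    1 ≤ kummerM a b z := by
  have := (summable_kummerM ha hab z).le_tsum 0 fun n _ =>
    div_nonneg (mul_nonneg (poch_div_nonneg ha hab n) (by positivity)) (by positivity)
  simpa [poch, kummerM] using this

lemma exists_hasDerivAt_kummerM {a b z : ℝ} (ha : 0 < a) (hab : a ≤ b) (hz : 0 ≤ z) :
    ∃ d : ℝ, HasDerivAt (kummerM a b) d z ∧ a / b ≤ d := by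
  have hle : ∀ (n : ℕ) (y : ℝ), y ∈ Metric.ball (0 : ℝ) (z + 1) →
      ‖poch a n / poch b n * (n * y ^ (n - 1)) / (n.factorial : ℝ)‖ ≤
        n * (z + 1) ^ (n - 1) / n.factorial := by
    intro n y hy
    rw [mem_ball_zero_iff] at hy
    rw [norm_div, norm_mul, Real.norm_of_nonneg (poch_div_nonneg ha hab n), norm_mul, norm_pow,
      Real.norm_natCast, Real.norm_natCast]
    refine div_le_div_of_nonneg_right ?_ (by positivity)
    refine (mul_le_of_le_one_left (by positivity) (poch_div_le_one ha hab n)).trans ?_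
    gcongr
  have hu : Summable fun n : ℕ => n * (z + 1) ^ (n - 1) / (n.factorial : ℝ) := by
    rw [← summable_nat_add_iff 1]
    refine (Real.summable_pow_div_factorial (z + 1)).congr fun n => ?_
    rw [Nat.factorial_succ, add_tsub_cancel_right]
    push_cast
    field_simp
  have hz' : z ∈ Metric.ball (0 : ℝ) (z + 1) := by
    rw [mem_ball_zero_iff, Real.norm_of_nonneg hz]; linarith
  refine ⟨_, hasDerivAt_tsum_of_isPreconnected hu Metric.isOpen_ball
    (convex_ball (0 : ℝ) (z + 1)).isPreconnected
    (fun n y _ => ((hasDerivAt_pow n y).const_mul _).div_const _) hle hz'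
    (summable_kummerM ha hab z) hz', ?_⟩
  have hs : Summable fun n : ℕ => poch a n / poch b n * (n * z ^ (n - 1)) / (n.factorial : ℝ) :=
    .of_norm_bounded hu fun n => hle n z hz'
  have := hs.le_tsum 1 fun n _ =>
    div_nonneg (mul_nonneg (poch_div_nonneg ha hab n) (by positivity)) (by positivity)
  simpa [poch] using this

lemma hasDerivAt_exp_mul_pow_mul {α : ℝ} {l : ℕ} (hl : l ≠ 0) {f : ℝ → ℝ} {d : ℝ}
    (hf : HasDerivAt f d (2 * α)) :
    HasDerivAt (fun r => Real.exp (-(α * r)) * (2 * α * r) ^ l * f (2 * α * r))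
      (Real.exp (-α) * (2 * α) ^ l * ((l - α) * f (2 * α) + 2 * α * d)) 1 := by
  have h1 : HasDerivAt (fun r => Real.exp (-(α * r))) (Real.exp (-(α * 1)) * -(α * 1)) 1 :=
    (((hasDerivAt_id (1 : ℝ)).const_mul α).neg).exp
  have h0 : HasDerivAt (fun r : ℝ => 2 * α * r) (2 * α * 1) 1 :=
    (hasDerivAt_id (1 : ℝ)).const_mul (2 * α)
  have h3 : HasDerivAt (fun r => f (2 * α * r)) (d * (2 * α * 1)) 1 :=
    HasDerivAt.comp 1 (by simpa using hf) h0
  refine ((h1.mul (h0.pow l)).mul h3).congr_deriv ?_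
  obtain ⟨j, rfl⟩ := Nat.exists_eq_succ_of_ne_zero hl
  simp only [Pi.mul_apply, Pi.pow_apply, mul_one, Nat.succ_eq_add_one, add_tsub_cancel_right, pow_succ]
  push_cast
  ring

section Bounds

variable {α : ℝ} {m : ℤ}

lemma half_le_kummer_param (m : ℤ) : 1 / 2 ≤ 1 / 2 + (m.natAbs : ℝ) + (m : ℝ) := by
  have h : -(m : ℝ) ≤ |(m : ℝ)| := neg_le_abs _
  rw [Nat.cast_natAbs, Int.cast_abs]
  linarith

lemma kummer_param_le (m : ℤ) :
    1 / 2 + (m.natAbs : ℝ) + (m : ℝ) ≤ 1 + 2 * (m.natAbs : ℝ) := by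
  have h : (m : ℝ) ≤ |(m : ℝ)| := le_abs_self _
  rw [Nat.cast_natAbs, Int.cast_abs]
  linarith

lemma kummer_param_pos (m : ℤ) : 0 < 1 / 2 + (m.natAbs : ℝ) + (m : ℝ) := by
  linarith [half_le_kummer_param m]

lemma vm_le (hα : 0 < α) {r : ℝ} (hr : 0 < r) (hr1 : r ≤ 1) :
    vm α m r ≤ Real.exp α * (2 * α * r) ^ m.natAbs := by
  have h := kummerM_le_exp (kummer_param_pos m) (kummer_param_le m)
    (by positivity : 0 ≤ 2 * α * r)
  unfold vm
  calc _ ≤ Real.exp (-(α * r)) * (2 * α * r) ^ m.natAbs * Real.exp (2 * α * r) := by gcongr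
    _ = Real.exp (α * r) * (2 * α * r) ^ m.natAbs := by
      rw [mul_right_comm, ← Real.exp_add]; ring_nf
    _ ≤ _ := by
      gcongr
      nlinarith

lemma vm_pos (hα : 0 < α) {r : ℝ} (hr : 0 < r) : 0 < vm α m r := by
  have h := one_le_kummerM (kummer_param_pos m) (kummer_param_le m)
    (by positivity : 0 ≤ 2 * α * r)
  unfold vm
  positivity

lemma le_vm_one (hα : 0 < α) : Real.exp (-α) * (2 * α) ^ m.natAbs ≤ vm α m 1 := by
  have h := one_le_kummerM (kummer_param_pos m) (kummer_param_le m)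
    (by positivity : 0 ≤ 2 * α)
  unfold vm
  rw [mul_one, mul_one]
  exact le_mul_of_one_le_right (by positivity) h

lemma abs_add_le_mul_natAbs (hα : 0 < α) (hm : m ≠ 0) :
    |(m : ℝ) + α| ≤ (1 + α) * m.natAbs := by
  have h1 : (1 : ℝ) ≤ m.natAbs := by exact_mod_cast Int.natAbs_pos.mpr hm
  have h2 : |(m : ℝ)| = m.natAbs := by rw [Nat.cast_natAbs, Int.cast_abs]
  have h3 := abs_add_le (m : ℝ) α
  rw [h2, abs_of_pos hα] at h3
  nlinarith

/-- A lower bound for `denomG α m / (|m + α| * vm α m 1)`, uniform in `m`. -/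
def denomConst (α : ℝ) : ℝ := Real.exp (-(2 * α)) / (1 + 2 * α)

lemma denomConst_pos (hα : 0 < α) : 0 < denomConst α := by
  unfold denomConst; positivity

lemma denomG_ge (hα : 0 < α) (hm : m ≠ 0) :
    denomConst α * |(m : ℝ) + α| * vm α m 1 ≤ denomG α m := by
  obtain ⟨d, hd, hdle⟩ := exists_hasDerivAt_kummerM (kummer_param_pos m) (kummer_param_le m)
    (by positivity : 0 ≤ 2 * α)
  have hl0 : m.natAbs ≠ 0 := Int.natAbs_ne_zero.mpr hm
  have hder : deriv (vm α m) 1 = _ := (hasDerivAt_exp_mul_pow_mul hl0 hd).deriv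
  have hM := one_le_kummerM (kummer_param_pos m) (kummer_param_le m)
    (by positivity : 0 ≤ 2 * α)
  have hMe := kummerM_le_exp (kummer_param_pos m) (kummer_param_le m)
    (by positivity : 0 ≤ 2 * α)
  have hv : vm α m 1 = Real.exp (-α) * (2 * α) ^ m.natAbs *
      kummerM (1 / 2 + (m.natAbs : ℝ) + (m : ℝ)) (1 + 2 * (m.natAbs : ℝ)) (2 * α) := by
    unfold vm; rw [mul_one, mul_one]
  set M := kummerM (1 / 2 + (m.natAbs : ℝ) + (m : ℝ)) (1 + 2 * (m.natAbs : ℝ)) (2 * α)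
  set E := Real.exp (-α) * (2 * α) ^ m.natAbs
  have hE : 0 < E := by positivity
  have hl1 : (1 : ℝ) ≤ m.natAbs := by exact_mod_cast Int.natAbs_pos.mpr hm
  have hc1 : denomConst α * (1 + 2 * α) ≤ 1 := by
    unfold denomConst
    rw [div_mul_cancel₀ _ (by positivity)]
    exact Real.exp_le_one_iff.mpr (by linarith)
  have hc0 := denomConst_pos hα
  have hd0 : 0 ≤ d := le_trans (div_nonneg (kummer_param_pos m).le (by positivity)) hdle
  have hmain : denomConst α * |(m : ℝ) + α| * M ≤
      (m.natAbs - α + |(m : ℝ) + α|) * M + 2 * α * d := by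
    have hc1' : denomConst α ≤ 1 := by nlinarith
    rcases le_or_gt α m.natAbs with h | h
    · nlinarith [mul_nonneg (abs_nonneg ((m : ℝ) + α)) (by linarith : 0 ≤ M), mul_nonneg hα.le hd0]
    · rcases lt_or_gt_of_ne hm with hneg | hpos
      · have hma : (m : ℝ) = -(m.natAbs : ℝ) := by
          rw [Nat.cast_natAbs, abs_of_neg hneg]; push_cast; ring
        have hμ : |(m : ℝ) + α| = α - m.natAbs := by
          rw [hma, abs_of_pos (by linarith)]; ring
        rw [hμ]
        have hd1 : (1 / 2) / (1 + 2 * α) ≤ d := by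
          refine le_trans ?_ hdle
          exact div_le_div₀ (kummer_param_pos m).le (half_le_kummer_param m) (by positivity)
            (by linarith)
        have : denomConst α * M ≤ 2 * d := by
          calc denomConst α * M ≤ denomConst α * Real.exp (2 * α) := by gcongr
            _ = 1 / (1 + 2 * α) := by
              unfold denomConst
              rw [div_mul_eq_mul_div, ← Real.exp_add]; simp
            _ = 2 * ((1 / 2) / (1 + 2 * α)) := by ring
            _ ≤ 2 * d := by linarith
        nlinarith [mul_nonneg hc0.le (by linarith : 0 ≤ M)]
      · have hma : (m : ℝ) = (m.natAbs : ℝ) := by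
          rw [Nat.cast_natAbs, abs_of_pos hpos]
        have hμ : |(m : ℝ) + α| = m.natAbs + α := by
          rw [← hma, abs_of_pos (by rw [hma]; positivity)]
        rw [hμ]
        have : denomConst α * ((m.natAbs : ℝ) + α) ≤ 2 * m.natAbs := by nlinarith
        nlinarith [mul_nonneg hα.le hd0]
  unfold denomG
  rw [hder, hv]
  calc denomConst α * |(m : ℝ) + α| * (E * M) = E * (denomConst α * |(m : ℝ) + α| * M) := by ring
    _ ≤ E * ((m.natAbs - α + |(m : ℝ) + α|) * M + 2 * α * d) := by gcongr
    _ = _ := by ring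

lemma um_eq (α : ℝ) (m : ℤ) : um α m = fun r =>
    Real.exp (-(α * r)) * (2 * α * r) ^ m.natAbs *
      ((Real.Gamma (1 / 2 + (m.natAbs : ℝ) + (m : ℝ)))⁻¹ *
        tricomiIntegral (1 / 2 + (m.natAbs : ℝ) + (m : ℝ)) (2 * m.natAbs) (2 * α * r)) := by
  funext r
  unfold um tricomiU tricomiIntegral tricomiKernel
  congr 3
  funext t
  rw [mul_assoc]
  congr 3
  push_cast
  ring

lemma Gamma_mul_um (α : ℝ) (m : ℤ) (r : ℝ) :
    Real.Gamma (1 / 2 + (m.natAbs : ℝ) + (m : ℝ)) * um α m r =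
    Real.exp (-(α * r)) * (2 * α * r) ^ m.natAbs *
      tricomiIntegral (1 / 2 + (m.natAbs : ℝ) + (m : ℝ)) (2 * m.natAbs) (2 * α * r) := by
  have := (Real.Gamma_pos_of_pos (kummer_param_pos m)).ne'
  rw [um_eq, mul_left_comm, mul_inv_cancel_left₀ this]

lemma Gamma_mul_um_nonneg (hα : 0 < α) {r : ℝ} (hr : 0 < r) :
    0 ≤ Real.Gamma (1 / 2 + (m.natAbs : ℝ) + (m : ℝ)) * um α m r := by
  rw [Gamma_mul_um]
  exact mul_nonneg (by positivity) (tricomiIntegral_nonneg _ _ _)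

/-- The constant in the bound for `um`. -/
def umConst (α : ℝ) : ℝ := 2 * Real.exp (2 * α) + 8 * α * Real.exp (4 * α)

lemma umConst_pos (hα : 0 < α) : 0 < umConst α := by
  unfold umConst; positivity

lemma pow_mul_tricomiIntegral_natAbs_le (hm : m ≠ 0) {z : ℝ} (hz : 0 < z) (hzα : z ≤ 2 * α) :
    z ^ m.natAbs * z ^ m.natAbs *
      tricomiIntegral (1 / 2 + (m.natAbs : ℝ) + (m : ℝ)) (2 * m.natAbs) z ≤
      umConst α * (2 * m.natAbs - 1).factorial := by
  have hl : 1 ≤ m.natAbs := Int.natAbs_pos.mpr hm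
  have h := pow_mul_tricomiIntegral_le (half_le_kummer_param m) (2 * m.natAbs - 1) hz hzα
  rwa [show 2 * m.natAbs - 1 + 1 = 2 * m.natAbs by omega,
    show z ^ (2 * m.natAbs) = z ^ m.natAbs * z ^ m.natAbs by rw [two_mul, pow_add]] at h

lemma pow_mul_Gamma_mul_um_le (hα : 0 < α) (hm : m ≠ 0) {r : ℝ} (hr : 0 < r) (hr1 : r ≤ 1) :
    (2 * α * r) ^ m.natAbs * (Real.Gamma (1 / 2 + (m.natAbs : ℝ) + (m : ℝ)) * um α m r) ≤
      umConst α * (2 * m.natAbs - 1).factorial := by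
  have h := pow_mul_tricomiIntegral_natAbs_le (α := α) hm (by positivity : 0 < 2 * α * r)
    (by nlinarith)
  refine le_trans ?_ h
  rw [Gamma_mul_um]
  have hT := tricomiIntegral_nonneg (1 / 2 + (m.natAbs : ℝ) + (m : ℝ)) (2 * m.natAbs) (2 * α * r)
  calc _ = Real.exp (-(α * r)) * ((2 * α * r) ^ m.natAbs * (2 * α * r) ^ m.natAbs *
        tricomiIntegral (1 / 2 + (m.natAbs : ℝ) + (m : ℝ)) (2 * m.natAbs) (2 * α * r)) := by ring
    _ ≤ _ := mul_le_of_le_one_left (by positivity) (Real.exp_le_one_iff.mpr (by nlinarith))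

lemma pow_mul_Gamma_mul_abs_deriv_um_le (hα : 0 < α) (hm : m ≠ 0) :
    (2 * α) ^ m.natAbs *
      (Real.Gamma (1 / 2 + (m.natAbs : ℝ) + (m : ℝ)) * |deriv (um α m) 1|) ≤
      ((1 + α) * umConst α + Real.exp (2 * α)) * (2 * m.natAbs).factorial := by
  have hl : 1 ≤ m.natAbs := Int.natAbs_pos.mpr hm
  have hl1 : (1 : ℝ) ≤ m.natAbs := by exact_mod_cast hl
  have hz : 0 < 2 * α := by positivity
  obtain ⟨d, hd, hdle⟩ := exists_hasDerivAt_tricomiIntegral (half_le_kummer_param m)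
    (2 * m.natAbs - 1) hz
  rw [show 2 * m.natAbs - 1 + 1 = 2 * m.natAbs by omega] at hd hdle
  rw [show 2 * m.natAbs - 1 + 2 = m.natAbs + m.natAbs + 1 by omega, pow_succ, pow_add] at hdle
  have hΓ := Real.Gamma_pos_of_pos (kummer_param_pos m)
  have hI := pow_mul_tricomiIntegral_natAbs_le (α := α) hm hz le_rfl
  have hT := tricomiIntegral_nonneg (1 / 2 + (m.natAbs : ℝ) + (m : ℝ)) (2 * m.natAbs) (2 * α)
  have hder := (hasDerivAt_exp_mul_pow_mul (by omega : m.natAbs ≠ 0)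
    (hd.const_mul (Real.Gamma (1 / 2 + (m.natAbs : ℝ) + (m : ℝ)))⁻¹)).deriv
  rw [← um_eq] at hder
  rw [show ∀ x : ℝ, Real.Gamma (1 / 2 + (m.natAbs : ℝ) + (m : ℝ)) * |x| =
    |Real.Gamma (1 / 2 + (m.natAbs : ℝ) + (m : ℝ)) * x| from fun x => by
      rw [abs_mul, abs_of_pos hΓ], hder]
  set T := tricomiIntegral (1 / 2 + (m.natAbs : ℝ) + (m : ℝ)) (2 * m.natAbs) (2 * α)
  set Γ := Real.Gamma (1 / 2 + (m.natAbs : ℝ) + (m : ℝ))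
  set P := (2 * α) ^ m.natAbs
  have hP : 0 < P := by positivity
  have heq : Γ * (Real.exp (-α) * P * ((m.natAbs - α) * (Γ⁻¹ * T) + 2 * α * (Γ⁻¹ * d))) =
      Real.exp (-α) * (P * ((m.natAbs - α) * T + 2 * α * d)) := by field_simp
  rw [heq, abs_mul, Real.abs_exp, abs_mul, abs_of_pos hP]
  have h1 : |((m.natAbs : ℝ) - α) * T + 2 * α * d| ≤ (1 + α) * m.natAbs * T + 2 * α * |d| := by
    refine (abs_add_le _ _).trans ?_
    rw [abs_mul, abs_mul (2 * α), abs_of_nonneg hT, abs_of_pos hz]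
    gcongr
    rw [abs_le]
    constructor <;> nlinarith
  have hfac : (m.natAbs : ℝ) * (2 * m.natAbs - 1).factorial ≤ (2 * m.natAbs).factorial := by
    rw [← Nat.mul_factorial_pred (by omega : 2 * m.natAbs ≠ 0)]
    push_cast
    gcongr
    linarith
  have he : Real.exp (-α) ≤ 1 := Real.exp_le_one_iff.mpr (by linarith)
  calc P * (Real.exp (-α) * (P * |((m.natAbs : ℝ) - α) * T + 2 * α * d|))
      ≤ P * (1 * (P * ((1 + α) * m.natAbs * T + 2 * α * |d|))) := by gcongr
    _ = (1 + α) * (m.natAbs * (P * P * T)) + P * P * (2 * α) * |d| := by ring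
    _ ≤ (1 + α) * (m.natAbs * (umConst α * (2 * m.natAbs - 1).factorial)) +
        Real.exp (2 * α) * (2 * m.natAbs).factorial := by gcongr
    _ = (1 + α) * umConst α * (m.natAbs * (2 * m.natAbs - 1).factorial) +
        Real.exp (2 * α) * (2 * m.natAbs).factorial := by ring
    _ ≤ (1 + α) * umConst α * (2 * m.natAbs).factorial +
        Real.exp (2 * α) * (2 * m.natAbs).factorial := by
      have := umConst_pos hα
      gcongr
    _ = _ := by ring


lemma Gm0aux_interior_le (hα : 0 < α) (hm : m ≠ 0) (hμ : 0 < |(m : ℝ) + α|) {r r' : ℝ}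
    (hr : 0 < r) (hrr : r < r') (hr1 : r' ≤ 1) :
    |Gm0aux α m r r'| ≤ (Real.exp α * umConst α * (1 + α) +
      Real.exp (3 * α) * (2 * (1 + α) * umConst α + Real.exp (2 * α)) / denomConst α) /
      |(m : ℝ) + α| * (r / r') ^ m.natAbs := by
  have hr' : 0 < r' := hr.trans hrr
  have hl : 1 ≤ m.natAbs := Int.natAbs_pos.mpr hm
  have hl1 : (1 : ℝ) ≤ m.natAbs := by exact_mod_cast hl
  have hc := denomConst_pos hα
  have hK := umConst_pos hα
  have hv := vm_le (m := m) hα hr (hrr.le.trans hr1)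
  have hv0 := vm_pos (m := m) hα hr
  have hv' := vm_le (m := m) hα hr' hr1
  have hv0' := vm_pos (m := m) hα hr'
  have hw := le_vm_one (m := m) hα
  have hD := denomG_ge hα hm
  have hu := pow_mul_Gamma_mul_um_le hα hm hr' hr1
  have hu0 := Gamma_mul_um_nonneg (m := m) hα hr'
  have hb := pow_mul_Gamma_mul_um_le hα hm one_pos le_rfl
  have hb0 := Gamma_mul_um_nonneg (m := m) hα one_pos
  have hb' := pow_mul_Gamma_mul_abs_deriv_um_le hα hm
  have hμl := abs_add_le_mul_natAbs hα hm
  have hΓ := Real.Gamma_pos_of_pos (kummer_param_pos m)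
  have hfac : ((2 * m.natAbs).factorial : ℝ) = 2 * m.natAbs * (2 * m.natAbs - 1).factorial := by
    rw [← Nat.mul_factorial_pred (by omega : 2 * m.natAbs ≠ 0)]
    push_cast
    ring
  have hP : 0 < (2 * α) ^ m.natAbs := by positivity
  have hx : 0 < r ^ m.natAbs := by positivity
  have hy : 0 < r' ^ m.natAbs := by positivity
  have hy1 : r' ^ m.natAbs ≤ 1 := pow_le_one₀ hr'.le hr1
  have hF : (0 : ℝ) < (2 * m.natAbs - 1).factorial := by positivity
  rw [Gm0aux, if_pos hr1, show 1 + 2 * (m.natAbs : ℝ) = ((2 * m.natAbs : ℕ) : ℝ) + 1 by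
    push_cast; ring, Real.Gamma_nat_eq_factorial, add_right_comm, div_pow, hfac]
  rw [hfac] at hb'
  rw [mul_one] at hb
  rw [mul_pow (2 * α)] at hv hv' hu
  set Γ := Real.Gamma (1 / 2 + (m.natAbs : ℝ) + (m : ℝ))
  set P := (2 * α) ^ m.natAbs
  set x := r ^ m.natAbs
  set y := r' ^ m.natAbs
  set μ := |(m : ℝ) + α|
  set F : ℝ := ((2 * m.natAbs - 1).factorial : ℝ)
  set l : ℝ := (m.natAbs : ℝ)
  set D := denomG α m
  set K := umConst α
  have hN : P * (Γ * |deriv (um α m) 1| + μ * (Γ * um α m 1)) ≤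
      (2 * (1 + α) * K + Real.exp (2 * α)) * (2 * l * F) := by
    calc P * (Γ * |deriv (um α m) 1| + μ * (Γ * um α m 1))
        = P * (Γ * |deriv (um α m) 1|) + μ * (P * (Γ * um α m 1)) := by ring
      _ ≤ ((1 + α) * K + Real.exp (2 * α)) * (2 * l * F) + (1 + α) * l * (K * F) := by gcongr
      _ ≤ _ := by
        have : 0 ≤ (1 + α) * l * (K * F) := by positivity
        linarith
  set N := Γ * |deriv (um α m) 1| + μ * (Γ * um α m 1)
  have hN0 : 0 ≤ N := by positivity
  have hD' : denomConst α * μ * (Real.exp (-α) * P) ≤ D := le_trans (by gcongr) hD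
  have hD0 : 0 < D := lt_of_lt_of_le (by positivity) hD'
  have h1 : vm α m r * (Γ * um α m r') / (2 * l * F) ≤
      Real.exp α * K * (1 + α) / μ * (x / y) := by
    have : Γ * um α m r' ≤ K * F / (P * y) := by rwa [le_div_iff₀' (by positivity)]
    calc vm α m r * (Γ * um α m r') / (2 * l * F)
        ≤ (Real.exp α * (P * x)) * (K * F / (P * y)) / (2 * l * F) := by gcongr
      _ = Real.exp α * K * (1 / (2 * l)) * (x / y) := by field_simp
      _ ≤ Real.exp α * K * ((1 + α) / μ) * (x / y) := by
        have : 1 / (2 * l) ≤ (1 + α) / μ := by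
          rw [div_le_div_iff₀ (by positivity) hμ]
          nlinarith
        exact mul_le_mul_of_nonneg_right (mul_le_mul_of_nonneg_left this (by positivity))
          (by positivity)
      _ = _ := by ring
  have h2 : vm α m r * (N / D * vm α m r') / (2 * l * F) ≤
      Real.exp (3 * α) * (2 * (1 + α) * K + Real.exp (2 * α)) / denomConst α / μ * (x / y) := by
    have hN' : N ≤ (2 * (1 + α) * K + Real.exp (2 * α)) * (2 * l * F) / P := by
      rwa [le_div_iff₀' hP]
    have hy2 : x * y ≤ x / y := by
      rw [le_div_iff₀ hy, mul_assoc]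
      exact mul_le_of_le_one_right hx.le (mul_le_one₀ hy1 hy.le hy1)
    calc vm α m r * (N / D * vm α m r') / (2 * l * F)
        ≤ (Real.exp α * (P * x)) * ((2 * (1 + α) * K + Real.exp (2 * α)) * (2 * l * F) / P /
          (denomConst α * μ * (Real.exp (-α) * P)) * (Real.exp α * (P * y))) / (2 * l * F) := by
          gcongr
      _ = Real.exp (3 * α) * (2 * (1 + α) * K + Real.exp (2 * α)) / denomConst α / μ *
          (x * y) := by
          rw [Real.exp_neg, show 3 * α = α + α + α by ring, Real.exp_add, Real.exp_add α α]
          field_simp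
      _ ≤ _ := by gcongr
  have hle : |Γ / (2 * l * F) * vm α m r * (um α m r' -
      (deriv (um α m) 1 + μ * um α m 1) / D * vm α m r')| ≤
      vm α m r * (Γ * um α m r') / (2 * l * F) + vm α m r * (N / D * vm α m r') / (2 * l * F) := by
    have heq : Γ / (2 * l * F) * vm α m r * (um α m r' -
        (deriv (um α m) 1 + μ * um α m 1) / D * vm α m r') =
        vm α m r / (2 * l * F) * (Γ * um α m r' -
        (Γ * deriv (um α m) 1 + μ * (Γ * um α m 1)) / D * vm α m r') := by
      field_simp
    have habs : |Γ * deriv (um α m) 1 + μ * (Γ * um α m 1)| ≤ N := by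
      refine (abs_add_le _ _).trans (le_of_eq ?_)
      rw [abs_mul, abs_of_pos hΓ, abs_of_nonneg (mul_nonneg hμ.le hb0)]
    rw [heq, abs_mul, abs_of_pos (by positivity)]
    calc _ ≤ vm α m r / (2 * l * F) * (Γ * um α m r' + N / D * vm α m r') := by
          gcongr
          refine (abs_sub _ _).trans ?_
          rw [abs_of_nonneg hu0, abs_mul, abs_div, abs_of_pos hD0, abs_of_pos hv0']
          gcongr
      _ = _ := by ring
  refine hle.trans ((add_le_add h1 h2).trans (le_of_eq ?_))
  ring

lemma vm_div_denomG_le (hα : 0 < α) (hm : m ≠ 0) (hμ : 0 < |(m : ℝ) + α|) {r : ℝ}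
    (hr : 0 < r) (hr1 : r ≤ 1) :
    vm α m r / denomG α m ≤
      Real.exp (2 * α) / denomConst α / |(m : ℝ) + α| * r ^ m.natAbs := by
  have hc := denomConst_pos hα
  have hD : denomConst α * |(m : ℝ) + α| * (Real.exp (-α) * (2 * α) ^ m.natAbs) ≤ denomG α m :=
    le_trans (mul_le_mul_of_nonneg_left (le_vm_one hα) (by positivity)) (denomG_ge hα hm)
  calc vm α m r / denomG α m ≤ Real.exp α * (2 * α * r) ^ m.natAbs /
        (denomConst α * |(m : ℝ) + α| * (Real.exp (-α) * (2 * α) ^ m.natAbs)) := by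
        gcongr
        exact vm_le hα hr hr1
    _ = _ := by
        rw [mul_pow (2 * α), Real.exp_neg, two_mul α, Real.exp_add]
        field_simp

lemma Gm0aux_exterior_le (hα : 0 < α) (hm : m ≠ 0) (hμ : 0 < |(m : ℝ) + α|) {r r' : ℝ}
    (hr : 1 < r) (hrr : r < r') :
    |Gm0aux α m r r'| ≤ (1 + 1 / denomConst α) / |(m : ℝ) + α| * (r / r') ^ |(m : ℝ) + α| := by
  have hc := denomConst_pos hα
  have hr0 : 0 < r := one_pos.trans hr
  have hr0' : 0 < r' := hr0.trans hrr
  have hv := vm_pos (m := m) hα one_pos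
  have hD := denomG_ge hα hm
  have hD0 : 0 < denomG α m := lt_of_lt_of_le (by positivity) hD
  rw [Gm0aux, if_neg (by linarith), if_neg (by linarith)]
  set μ := |(m : ℝ) + α|
  have hq : |(deriv (vm α m) 1 - μ * vm α m 1) / denomG α m| ≤ 1 + 2 / denomConst α := by
    rw [abs_div, abs_of_pos hD0, div_le_iff₀ hD0]
    have h1 : deriv (vm α m) 1 - μ * vm α m 1 = denomG α m - 2 * (μ * vm α m 1) := by
      unfold denomG; ring
    have h2 : μ * vm α m 1 ≤ denomG α m / denomConst α := by
      rw [le_div_iff₀ hc]; linarith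
    rw [h1]
    refine (abs_sub _ _).trans ?_
    rw [abs_of_pos hD0, abs_of_pos (by positivity)]
    calc _ ≤ denomG α m + 2 * (denomG α m / denomConst α) := by gcongr
      _ = _ := by ring
  have hpow : (r * r') ^ (-μ) ≤ (r / r') ^ μ := by
    rw [Real.rpow_neg (by positivity), ← Real.inv_rpow (by positivity)]
    apply Real.rpow_le_rpow (by positivity) _ hμ.le
    rw [mul_inv, div_eq_mul_inv]
    gcongr
    exact (inv_le_one_of_one_le₀ hr.le).trans hr.le
  rw [abs_mul, abs_of_pos (by positivity : 0 < 1 / (2 * μ))]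
  calc _ ≤ 1 / (2 * μ) * ((r / r') ^ μ + (1 + 2 / denomConst α) * (r / r') ^ μ) := by
        gcongr
        refine (abs_sub _ _).trans ?_
        rw [abs_mul, abs_of_pos (by positivity : 0 < (r / r') ^ μ),
          abs_of_pos (by positivity : 0 < (r * r') ^ (-μ))]
        gcongr
    _ = _ := by field_simp; ring

end Bounds

theorem stmt18 (α : ℝ) (hα : 0 < α) (hαZ : ∀ n : ℤ, α ≠ (n:ℝ)) :
    ∃ C : ℝ, 0 < C ∧ ∀ m : ℤ, m ≠ 0 →
      (∀ r r' : ℝ, 0 < r → r < r' → r' ≤ 1 →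
        |Gm0 α m r r'| ≤ C / |(m:ℝ) + α| * (r/r') ^ (m.natAbs)) ∧
      (∀ r r' : ℝ, 1 ≤ r → r < r' →
        |Gm0 α m r r'| ≤ C / |(m:ℝ) + α| * (r/r') ^ |(m:ℝ) + α|) ∧
      (∀ r r' : ℝ, 0 < r → r < 1 → 1 < r' →
        |Gm0 α m r r'| ≤ C / |(m:ℝ) + α| * r ^ (m.natAbs) * r' ^ (-|(m:ℝ) + α|)) := by
  have hc := denomConst_pos hα
  have hK := umConst_pos hα
  set C₁ := Real.exp α * umConst α * (1 + α) +
    Real.exp (3 * α) * (2 * (1 + α) * umConst α + Real.exp (2 * α)) / denomConst α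
  set C₂ := 1 + 1 / denomConst α
  set C₃ := Real.exp (2 * α) / denomConst α
  have h₁ : 0 < C₁ := by positivity
  have h₂ : 0 < C₂ := by positivity
  have h₃ : 0 < C₃ := by positivity
  refine ⟨C₁ + C₂ + C₃, by positivity, fun m hm => ?_⟩
  have hμ : 0 < |(m : ℝ) + α| := abs_pos.mpr fun h => hαZ (-m) (by push_cast; linarith)
  have hD0 : 0 < denomG α m :=
    lt_of_lt_of_le (by have := vm_pos (m := m) hα one_pos; positivity) (denomG_ge hα hm)
  have hmix : ∀ r r' : ℝ, 0 < r → r ≤ 1 → 1 < r' →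
      |Gm0aux α m r r'| ≤
        (C₁ + C₂ + C₃) / |(m : ℝ) + α| * r ^ m.natAbs * r' ^ (-|(m : ℝ) + α|) := by
    intro r r' hr hr1 hr1'
    have hr' : 0 < r' := one_pos.trans hr1'
    have hv := vm_pos (m := m) hα hr
    rw [Gm0aux, if_neg (by linarith), if_pos hr1, mul_div_right_comm,
      abs_of_pos (by positivity)]
    gcongr
    refine (vm_div_denomG_le hα hm hμ hr hr1).trans ?_
    gcongr
    linarith
  refine ⟨fun r r' hr hrr hr1 => ?_, fun r r' hr hrr => ?_, fun r r' hr hr1 hr1' => ?_⟩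
  · have hr' : 0 < r' := hr.trans hrr
    rw [Gm0, if_pos hrr.le]
    refine (Gm0aux_interior_le hα hm hμ hr hrr hr1).trans ?_
    exact mul_le_mul_of_nonneg_right
      (div_le_div_of_nonneg_right (by linarith : C₁ ≤ C₁ + C₂ + C₃) hμ.le) (by positivity)
  · have hr0 : 0 < r := by linarith
    have hr' : 0 < r' := hr0.trans hrr
    rw [Gm0, if_pos hrr.le]
    rcases hr.eq_or_lt with rfl | hr
    · have := hmix 1 r' one_pos le_rfl hrr
      rwa [one_pow, mul_one, Real.rpow_neg hr'.le, ← Real.inv_rpow hr'.le, ← one_div] at this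
    · refine (Gm0aux_exterior_le hα hm hμ hr hrr).trans ?_
      exact mul_le_mul_of_nonneg_right
        (div_le_div_of_nonneg_right (by linarith : C₂ ≤ C₁ + C₂ + C₃) hμ.le) (by positivity)
  · rw [Gm0, if_pos (by linarith)]
    exact hmix r r' hr hr1.le hr1'
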